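/- (𝕃 is left adjoint to the forgetful functor from vector spaces to affine spaces.) For every k-vector space W and every affine map φ: V̄ → W there is a unique k-linear map φ̃: 𝕃(V̄) → W such that φ̃(q,1) = φ(q) for all q ∈ V̄; explicitly, φ̃(q,t) = t·φ(q) for t ≠ 0 and φ̃(v,0) = Dφ(v), where Dφ denotes the linear part of φ. Consequently, restriction along q ↦ (q,1) is a bijection between the set of k-linear maps 𝕃(V̄) → W and the set of affine maps V̄ → W. -/

import Mathlib

/-- The underlying set of the cone construction `𝕃(V̄)`: pairs `(q,t)` with `q ∈ V̄`
and `t ∈ k \ {0}`, together with the pairs `(v,0)` with `v ∈ V`. -/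
def LCone (k V Vb : Type*) [Field k] [AddCommGroup V] [Module k V] [AddTorsor V Vb] :
    Type _ :=
  (Vb × {t : k // t ≠ 0}) ⊕ V

namespace LCone

variable {k V Vb : Type*} [Field k] [AddCommGroup V] [Module k V] [AddTorsor V Vb]

open scoped Classical

/-- The addition on `𝕃(V̄)`:
`(p,t) + (q,s) = ((t/(t+s))·p + (s/(t+s))·q, t+s)` if `t, s, t+s ≠ 0`;
`(p,t) + (v,0) = ((1/t)·v + p, t)`;
`(p,t) + (q,s) = (t·(p − q), 0)` if `t ≠ 0`, `t + s = 0`;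
`(u,0) + (v,0) = (u + v, 0)`.
(The affine combination `(t/(t+s))·p + (s/(t+s))·q` is `(t/(t+s))·(p − q) + q`.) -/
noncomputable def add : LCone k V Vb → LCone k V Vb → LCone k V Vb
  | Sum.inl (p, t), Sum.inl (q, s) =>
      if h : (t : k) + (s : k) ≠ 0 then
        Sum.inl (((((t : k) / ((t : k) + (s : k))) • (p -ᵥ q)) +ᵥ q), ⟨(t : k) + (s : k), h⟩)
      else
        Sum.inr ((t : k) • (p -ᵥ q))
  | Sum.inl (p, t), Sum.inr v => Sum.inl ((((t : k)⁻¹ • v) +ᵥ p), t)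
  | Sum.inr v, Sum.inl (p, t) => Sum.inl ((((t : k)⁻¹ • v) +ᵥ p), t)
  | Sum.inr u, Sum.inr v => Sum.inr (u + v)

/-- The scalar multiplication on `𝕃(V̄)`:
`s·(q,t) = (q, st)` if `s, t ≠ 0`; `s·(q,t) = (0,0)` if `s = 0`; `s·(v,0) = (s·v, 0)`. -/
noncomputable def smul (a : k) : LCone k V Vb → LCone k V Vb
  | Sum.inl (q, t) =>
      if h : a ≠ 0 then Sum.inl (q, ⟨a * (t : k), mul_ne_zero h t.2⟩) else Sum.inr 0
  | Sum.inr v => Sum.inr (a • v)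

/-- The zero vector `(0,0)` of `𝕃(V̄)`. -/
def zero : LCone k V Vb := Sum.inr 0

/-- The degree map `deg : 𝕃(V̄) → k`, `(q,t) ↦ t`, `(v,0) ↦ 0`. -/
def deg : LCone k V Vb → k
  | Sum.inl (_, t) => t
  | Sum.inr _ => 0

/-- The embedding of the affine space `V̄` into `𝕃(V̄)` as the hyperplane of height 1. -/
def emb (q : Vb) : LCone k V Vb := Sum.inl (q, ⟨1, one_ne_zero⟩)

end LCone

namespace LCone

variable {k V Vb W : Type*} [Field k] [AddCommGroup V] [Module k V] [AddTorsor V Vb]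
  [AddCommGroup W]

theorem add_inr_emb (v : V) (q : Vb) :
    add (Sum.inr v) (emb q : LCone k V Vb) = emb (v +ᵥ q) := by
  simp [add, emb]
  rfl

theorem map_emb_vadd {F : LCone k V Vb → W} (hadd : ∀ x y, F (add x y) = F x + F y)
    (v : V) (q : Vb) : F (emb (v +ᵥ q)) = F (Sum.inr v) + F (emb q) :=
  (congrArg F (add_inr_emb v q)).symm.trans (hadd _ _)

variable [Module k W]

/-- The extension of an affine map `V̄ → W` to `𝕃(V̄)`. -/
def lift (f : Vb →ᵃ[k] W) : LCone k V Vb → W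
  | Sum.inl (q, t) => (t : k) • f q
  | Sum.inr v => f.linear v

theorem lift_emb (f : Vb →ᵃ[k] W) (q : Vb) : lift f (emb q) = f q :=
  one_smul k (f q)

theorem lift_add (f : Vb →ᵃ[k] W) (x y : LCone k V Vb) :
    lift f (add x y) = lift f x + lift f y := by
  rcases x with ⟨p, t, ht⟩ | u <;> rcases y with ⟨q, s, hs⟩ | v
  · by_cases h : t + s = 0
    · obtain rfl : s = -t := eq_neg_of_add_eq_zero_right h
      simp [add, lift, sub_eq_add_neg]
    · have hlift : lift f (add (Sum.inl (p, ⟨t, ht⟩)) (Sum.inl (q, ⟨s, hs⟩))) =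
          (t + s) • f ((t / (t + s)) • (p -ᵥ q) +ᵥ q) :=
        congrArg (lift f) (dif_pos h)
      rw [hlift, f.map_vadd, map_smul, f.linearMap_vsub, vadd_eq_add, smul_add, smul_smul,
        mul_div_cancel₀ t h, vsub_eq_sub]
      change _ = t • f p + s • f q
      module
  · simp [add, lift, smul_smul, ht, add_comm]
  · simp [add, lift, smul_smul, hs]
  · simp [add, lift]

theorem lift_smul (f : Vb →ᵃ[k] W) (a : k) (x : LCone k V Vb) :
    lift f (smul a x) = a • lift f x := by
  rcases x with ⟨q, t, ht⟩ | v
  · by_cases h : a = 0 <;> simp [smul, lift, h, mul_smul]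
  · simp [smul, lift]

theorem smul_emb (q : Vb) {t : k} (ht : t ≠ 0) :
    smul t (emb q : LCone k V Vb) = Sum.inl (q, ⟨t, ht⟩) := by
  simp [smul, emb, ht]
  rfl

theorem map_inl {F : LCone k V Vb → W} (hsmul : ∀ (a : k) x, F (smul a x) = a • F x)
    (q : Vb) {t : k} (ht : t ≠ 0) : F (Sum.inl (q, ⟨t, ht⟩)) = t • F (emb q) :=
  (congrArg F (smul_emb q ht)).symm.trans (hsmul t _)

theorem ext_of_emb {F G : LCone k V Vb → W}
    (hF : ∀ x y, F (add x y) = F x + F y) (hF' : ∀ (a : k) x, F (smul a x) = a • F x)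
    (hG : ∀ x y, G (add x y) = G x + G y) (hG' : ∀ (a : k) x, G (smul a x) = a • G x)
    (h : ∀ q, F (emb q) = G (emb q)) : F = G := by
  funext x
  rcases x with ⟨q, t, ht⟩ | v
  · rw [map_inl hF', map_inl hG', h]
  · obtain ⟨q⟩ : Nonempty Vb := AddTorsor.nonempty
    have := map_emb_vadd hF v q
    rw [h, h, map_emb_vadd hG] at this
    exact (add_right_cancel this).symm

end LCone

/-- **`𝕃` is left adjoint to the forgetful functor from vector spaces to affine
spaces.**  For every `k`-vector space `W` and every affine map `φ : V̄ → W` (with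
linear part `Dφ = D`), there is a unique `k`-linear map `φ̃ : 𝕃(V̄) → W` with
`φ̃(q,1) = φ(q)` for all `q ∈ V̄`; explicitly, `φ̃(q,t) = t·φ(q)` for `t ≠ 0` and
`φ̃(v,0) = Dφ(v)`.  Consequently, restriction along `q ↦ (q,1)` is a bijection between
the set of `k`-linear maps `𝕃(V̄) → W` and the set of affine maps `V̄ → W`. -/
theorem lCone_left_adjoint
    (k V Vb : Type*) [Field k] [AddCommGroup V] [Module k V] [AddTorsor V Vb]
    (W : Type*) [AddCommGroup W] [Module k W]
    (φ : Vb → W) (D : V → W)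
    (hD_add : ∀ u v : V, D (u + v) = D u + D v)
    (hD_smul : ∀ (a : k) (v : V), D (a • v) = a • D v)
    (hφ : ∀ (v : V) (q : Vb), φ (v +ᵥ q) = D v + φ q) :
    -- existence and uniqueness of the `k`-linear extension `φ̃`
    (∃! F : LCone k V Vb → W,
      (∀ x y : LCone k V Vb, F (LCone.add x y) = F x + F y) ∧
      (∀ (a : k) (x : LCone k V Vb), F (LCone.smul a x) = a • F x) ∧
      (∀ q : Vb, F (LCone.emb q) = φ q)) ∧
    -- the explicit formula for any such extension
    (∀ F : LCone k V Vb → W,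
      ((∀ x y : LCone k V Vb, F (LCone.add x y) = F x + F y) ∧
       (∀ (a : k) (x : LCone k V Vb), F (LCone.smul a x) = a • F x) ∧
       (∀ q : Vb, F (LCone.emb q) = φ q)) →
      (∀ (q : Vb) (t : k) (ht : t ≠ 0), F (Sum.inl (q, ⟨t, ht⟩)) = t • φ q) ∧
      (∀ v : V, F (Sum.inr v) = D v)) ∧
    -- restriction along `q ↦ (q,1)` is a bijection from linear maps to affine maps
    Set.BijOn (fun (F : LCone k V Vb → W) => (fun q : Vb => F (LCone.emb q)))
      {F | (∀ x y : LCone k V Vb, F (LCone.add x y) = F x + F y) ∧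
           (∀ (a : k) (x : LCone k V Vb), F (LCone.smul a x) = a • F x)}
      {f | ∃ D' : V → W, (∀ u v : V, D' (u + v) = D' u + D' v) ∧
           (∀ (a : k) (v : V), D' (a • v) = a • D' v) ∧
           (∀ (v : V) (q : Vb), f (v +ᵥ q) = D' v + f q)} := by
  have lift_of_affine : ∀ (f : Vb → W) (L : V → W), (∀ u v, L (u + v) = L u + L v) →
      (∀ (a : k) v, L (a • v) = a • L v) → (∀ v q, f (v +ᵥ q) = L v + f q) →
      ∃ F : LCone k V Vb → W,
        (∀ x y, F (LCone.add x y) = F x + F y) ∧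
        (∀ (a : k) x, F (LCone.smul a x) = a • F x) ∧
        (∀ q, F (LCone.emb q) = f q) := fun f L hadd hsmul hf =>
    let g : Vb →ᵃ[k] W := ⟨f, ⟨⟨L, hadd⟩, hsmul⟩, fun q v => hf v q⟩
    ⟨LCone.lift g, LCone.lift_add g, LCone.lift_smul g, LCone.lift_emb g⟩
  refine ⟨?_, ?_, ?_, ?_, ?_⟩
  · obtain ⟨F, hF, hF', hFφ⟩ := lift_of_affine φ D hD_add hD_smul hφ
    refine ⟨F, ⟨hF, hF', hFφ⟩, ?_⟩
    rintro G ⟨hG, hG', hGφ⟩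
    exact LCone.ext_of_emb hG hG' hF hF' fun q => (hGφ q).trans (hFφ q).symm
  · rintro F ⟨hF, hF', hFφ⟩
    refine ⟨fun q t ht => by rw [LCone.map_inl hF', hFφ], fun v => ?_⟩
    obtain ⟨q⟩ : Nonempty Vb := AddTorsor.nonempty
    have := LCone.map_emb_vadd hF v q
    rw [hFφ, hFφ, hφ] at this
    exact (add_right_cancel this).symm
  · rintro F ⟨hF, hF'⟩
    exact ⟨fun v => F (Sum.inr v), fun u v => hF (Sum.inr u) (Sum.inr v),
      fun a v => hF' a (Sum.inr v), LCone.map_emb_vadd hF⟩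
  · rintro F ⟨hF, hF'⟩ G ⟨hG, hG'⟩ h
    exact LCone.ext_of_emb hF hF' hG hG' (congrFun h)
  · rintro f ⟨L, hadd, hsmul, hf⟩
    obtain ⟨F, hF, hF', hFf⟩ := lift_of_affine f L hadd hsmul hf
    exact ⟨F, ⟨hF, hF'⟩, funext hFf⟩
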